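/- arXiv:1411.3995 — 2 statements merged into one kernel-verified Lean document; each statement's English description precedes it below -/
import Mathlib

section
/- A real X is Martin-Löf BP random if and only if X passes every weak primitive recursive test, i.e., for every weak primitive recursive test (U_n) there is some n with X ∉ U_n. -/
namespace BP



/-- The finite binary string `(X 0, …, X (n−1))`. -/
def take (X : ℕ → Bool) (n : ℕ) : List Bool := (List.range n).map X

/-- `X ∈ [G]`: the real `X` extends some string of the finite set (list) `G`. -/
def Mem (X : ℕ → Bool) (G : List (List Bool)) : Prop :=
  ∃ τ ∈ G, take X τ.length = τ

/-- The maximum length of a string in `G`. -/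
def maxLen (G : List (List Bool)) : ℕ := (G.map List.length).foldr max 0

/-- The list of all binary strings of length `L`. -/
def allStrings (L : ℕ) : List (List Bool) :=
  (List.range (2 ^ L)).map fun k => (List.range L).map fun i => k.testBit i

/-- The uniform (fair-coin) measure of the clopen set `[G]`, computed by counting
which strings of length `maxLen G` extend a member of `G`. -/
def mu (G : List (List Bool)) : ℚ :=
  (((allStrings (maxLen G)).filter fun σ => G.any fun τ => decide (τ <+: σ)).length : ℚ)
    / 2 ^ maxLen G

/-- The uniform measure of `[G] ∩ [τ]`. -/
def muCap (G : List (List Bool)) (τ : List Bool) : ℚ :=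
  (((allStrings (max (maxLen G) τ.length)).filter fun σ =>
      decide (τ <+: σ) && (G.any fun ρ => decide (ρ <+: σ))).length : ℚ)
    / 2 ^ max (maxLen G) τ.length

/-- A primitive recursive test: a primitive recursive sequence of finite sets of
binary strings with `μ([Gₙ]) ≤ 2⁻ⁿ`. -/
def IsTest (G : ℕ → List (List Bool)) : Prop :=
  Primrec G ∧ ∀ n, mu (G n) ≤ ((2 : ℚ) ^ n)⁻¹

/-- `X` is Martin-Löf BP random. -/
def MLBPRandom (X : ℕ → Bool) : Prop :=
  ∀ G : ℕ → List (List Bool), IsTest G → ∃ n, ¬ Mem X (G n)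

/-- A weak primitive recursive test. -/
def IsWeakTest (G : ℕ → List (List Bool)) : Prop :=
  IsTest G ∧ ∃ ℓ : ℕ → ℕ, Primrec ℓ ∧ (∀ n, ∀ τ ∈ G n, τ.length = ℓ n) ∧
    ∀ n, ∀ τ ∈ G n, muCap (G (n + 1)) τ ≤ (1 / 2) * ((2 : ℚ) ^ τ.length)⁻¹

/-- A martingale with values in the nonnegative rationals. -/
def IsMartingale (d : List Bool → ℚ) : Prop :=
  d [] = 1 ∧ (∀ σ, 0 ≤ d σ) ∧
    ∀ σ, d σ = (d (σ ++ [false]) + d (σ ++ [true])) / 2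

/-- The martingale `d` succeeds primitive recursively on `X`. -/
def SucceedsPR (d : List Bool → ℚ) (X : ℕ → Bool) : Prop :=
  ∃ f : ℕ → ℕ, Primrec f ∧ ∀ n, (2 : ℚ) ^ n ≤ d (take X (f n))

/-- `X` is martingale BP random. -/
def MartingaleBPRandom (X : ℕ → Bool) : Prop :=
  ¬ ∃ d : List Bool → ℚ, Primrec d ∧ IsMartingale d ∧ SucceedsPR d X

/-- `X` is primitive recursively compressed by the machine `M`. -/
def CompressedBy (M : List Bool → List Bool) (X : ℕ → Bool) : Prop :=
  ∃ f : ℕ → ℕ, Primrec f ∧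
    ∀ c, ∃ σ : List Bool, σ.length ≤ f c - c ∧ M σ = take X (f c)

/-- `X` is Kolmogorov BP random. -/
def KolmogorovBPRandom (X : ℕ → Bool) : Prop :=
  ¬ ∃ M : List Bool → List Bool, Primrec M ∧ CompressedBy M X

/-- `M` is a (total) process machine: it is extension preserving. -/
def IsProcessMachine (M : List Bool → List Bool) : Prop :=
  ∀ σ τ : List Bool, σ <+: τ → M σ <+: M τ

/-- `M` is a quick process BP machine. -/
def IsQuickProcessBP (M : List Bool → List Bool) : Prop :=
  Primrec M ∧ IsProcessMachine M ∧
    ∃ h : ℕ → ℕ, Primrec h ∧ Monotone h ∧ (∀ k, ∃ n, k ≤ h n) ∧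
      ∀ τ : List Bool, h τ.length ≤ (M τ).length

/-- `X` is quick process BP random. -/
def QuickProcessBPRandom (X : ℕ → Bool) : Prop :=
  ¬ ∃ M : List Bool → List Bool, IsQuickProcessBP M ∧ CompressedBy M X

/-- The number of `i < n` with `X i = true`. -/
def cardBelow (X : ℕ → Bool) (n : ℕ) : ℕ := (List.range n).countP X




theorem primrec_maxLen : Primrec maxLen := by
  have h : Primrec₂ fun (_ : List (List Bool)) (p : ℕ × ℕ) => max p.1 p.2 :=
    (Primrec.nat_max.comp (Primrec.fst.comp .snd) (Primrec.snd.comp .snd)).to₂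
  have hlen : Primrec₂ fun (_ : List (List Bool)) (τ : List Bool) => τ.length :=
    (Primrec.list_length.comp .snd).to₂
  exact Primrec.list_foldr (Primrec.list_map .id hlen) (Primrec.const 0) h

theorem primrec_two_pow : Primrec fun n : ℕ => 2 ^ n :=
  (Primrec₂.unpaired'.1 Nat.Primrec.pow).comp (Primrec.const 2) .id

theorem primrec_testBit : Primrec₂ Nat.testBit := by
  have h : Primrec fun p : ℕ × ℕ => decide (p.1 / 2 ^ p.2 % 2 = 1) :=
    (Primrec.eq.comp (Primrec.nat_mod.comp (Primrec.nat_div.comp .fst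
      (primrec_two_pow.comp .snd)) (Primrec.const 2)) (Primrec.const 1)).decide
  exact h.of_eq fun p => (Nat.testBit_eq_decide_div_mod_eq).symm

theorem primrec_allStrings : Primrec allStrings := by
  have h : Primrec₂ fun L k : ℕ => (List.range L).map fun i => k.testBit i :=
    (Primrec.list_map (Primrec.list_range.comp .fst)
      (primrec_testBit.comp (Primrec.snd.comp .fst) .snd).to₂).to₂
  exact Primrec.list_map (Primrec.list_range.comp primrec_two_pow) h

theorem primrecRel_isPrefix : PrimrecRel fun τ σ : List Bool => τ <+: σ := by
  have h : PrimrecRel fun τ σ : List Bool => τ = σ.take τ.length :=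
    Primrec.eq.comp .fst (Primrec.list_take.comp (Primrec.list_length.comp .fst) .snd)
  exact h.of_eq fun τ σ => List.prefix_iff_eq_take.symm

/-- The strings of length `maxLen G` which extend a member of `G`. -/
def fill (G : List (List Bool)) : List (List Bool) :=
  (allStrings (maxLen G)).filter fun σ => G.any fun τ => decide (τ <+: σ)

theorem primrec_fill : Primrec fill := by
  classical
  have h : PrimrecRel fun (σ : List Bool) (G : List (List Bool)) => ∃ τ ∈ G, τ <+: σ :=
    primrecRel_isPrefix.exists_mem_list.comp .snd .fst
  refine (h.listFilter.comp (primrec_allStrings.comp primrec_maxLen) .id).of_eq fun G => ?_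
  refine List.filter_congr fun σ _ => ?_
  rw [Bool.eq_iff_iff]
  simp

theorem length_of_mem_allStrings {L : ℕ} {σ : List Bool} (h : σ ∈ allStrings L) :
    σ.length = L := by
  obtain ⟨k, -, rfl⟩ := List.mem_map.1 h
  simp

theorem take_mem_allStrings (X : ℕ → Bool) (L : ℕ) : take X L ∈ allStrings L := by
  refine List.mem_map.2 ⟨Nat.ofBits fun i : Fin L => X i,
    List.mem_range.2 (Nat.ofBits_lt_two_pow _), List.map_congr_left fun i hi => ?_⟩
  exact Nat.testBit_ofBits_lt _ i (List.mem_range.1 hi)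

theorem length_of_mem_fill {G : List (List Bool)} {σ : List Bool} (h : σ ∈ fill G) :
    σ.length = maxLen G :=
  length_of_mem_allStrings (List.mem_filter.1 h).1

theorem length_le_maxLen {G : List (List Bool)} {τ : List Bool} (h : τ ∈ G) :
    τ.length ≤ maxLen G := by
  induction G with
  | nil => simp at h
  | cons a G ih =>
    have hc : maxLen (a :: G) = max a.length (maxLen G) := rfl
    rcases List.mem_cons.1 h with rfl | h
    · exact hc ▸ le_max_left _ _
    · exact hc ▸ (ih h).trans (le_max_right _ _)

theorem maxLen_eq_of_forall_length {G : List (List Bool)} {L : ℕ} (hne : G ≠ [])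
    (h : ∀ τ ∈ G, τ.length = L) : maxLen G = L := by
  induction G with
  | nil => exact absurd rfl hne
  | cons a G ih =>
    have hc : maxLen (a :: G) = max a.length (maxLen G) := rfl
    have ha := h a (by simp)
    by_cases hG : G = []
    · subst hG
      simp [ha, maxLen]
    · rw [hc, ih hG fun τ hτ => h τ (by simp [hτ]), ha, max_self]

theorem maxLen_fill {G : List (List Bool)} (hne : fill G ≠ []) : maxLen (fill G) = maxLen G :=
  maxLen_eq_of_forall_length hne fun _ => length_of_mem_fill

theorem isPrefix_take {X : ℕ → Bool} {m n : ℕ} (h : m ≤ n) : take X m <+: take X n := by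
  rw [List.prefix_iff_eq_take]
  simp [take, ← List.map_take, List.take_range, h]

theorem mem_fill {X : ℕ → Bool} {G : List (List Bool)} (h : Mem X G) : Mem X (fill G) := by
  obtain ⟨τ, hτ, hX⟩ := h
  refine ⟨take X (maxLen G), List.mem_filter.2 ⟨take_mem_allStrings _ _, ?_⟩, ?_⟩
  · refine List.any_eq_true.2 ⟨τ, hτ, decide_eq_true ?_⟩
    have := isPrefix_take (X := X) (length_le_maxLen hτ)
    rwa [hX] at this
  · simp [take]

theorem mu_eq (G : List (List Bool)) : mu G = ((fill G).length : ℚ) / 2 ^ maxLen G := rfl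

theorem fill_fill {G : List (List Bool)} : fill (fill G) = fill G := by
  by_cases hne : fill G = []
  · rw [hne]
    simp [fill]
  · rw [fill, maxLen_fill hne]
    conv_rhs => rw [fill]
    refine List.filter_congr fun σ hσ => ?_
    rw [Bool.eq_iff_iff]
    constructor
    · intro h
      obtain ⟨ρ, hρ, hp⟩ := List.any_eq_true.1 h
      have : ρ = σ := (of_decide_eq_true hp).eq_of_length
        ((length_of_mem_fill hρ).trans (length_of_mem_allStrings hσ).symm)
      exact this ▸ (List.mem_filter.1 hρ).2
    · intro h
      exact List.any_eq_true.2 ⟨σ, List.mem_filter.2 ⟨hσ, h⟩, by simp⟩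

theorem mu_fill (G : List (List Bool)) : mu (fill G) = mu G := by
  rw [mu_eq, mu_eq, fill_fill]
  by_cases hne : fill G = []
  · simp [hne]
  · rw [maxLen_fill hne]

theorem muCap_le_mu {G : List (List Bool)} {τ : List Bool} (h : τ.length ≤ maxLen G) :
    muCap G τ ≤ mu G := by
  rw [muCap, mu, max_eq_left h]
  gcongr
  refine (List.monotone_filter_right _ fun σ hσ => ?_).length_le
  exact (Bool.and_eq_true_iff.1 hσ).2

theorem le_maxLen_of_mu_le {G : List (List Bool)} {m : ℕ} (hne : fill G ≠ [])
    (h : mu G ≤ ((2 : ℚ) ^ m)⁻¹) : m ≤ maxLen G := by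
  rw [mu_eq] at h
  have h₁ : (1 : ℚ) ≤ (fill G).length := by
    exact_mod_cast List.length_pos_iff.2 hne
  have h₂ : ((2 : ℚ) ^ maxLen G)⁻¹ ≤ ((2 : ℚ) ^ m)⁻¹ := by
    refine le_trans ?_ h
    rw [inv_eq_one_div]
    gcongr
  rw [inv_le_inv₀ (by positivity) (by positivity)] at h₂
  exact (pow_le_pow_iff_right₀ (by norm_num)).1 h₂

/-- Indices along which a test, once its members are filled up to a common length,
becomes a weak test. -/
def weakIndex (G : ℕ → List (List Bool)) : ℕ → ℕ :=
  Nat.rec 0 fun _ m => maxLen (G m) + m + 1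

theorem primrec_weakIndex {G : ℕ → List (List Bool)} (hG : Primrec G) :
    Primrec (weakIndex G) := by
  refine Primrec.nat_rec₁ 0 ?_
  exact (Primrec.succ.comp (Primrec.nat_add.comp
    (primrec_maxLen.comp (hG.comp .snd)) .snd)).to₂

theorem weakIndex_succ (G : ℕ → List (List Bool)) (n : ℕ) :
    weakIndex G (n + 1) = maxLen (G (weakIndex G n)) + weakIndex G n + 1 := rfl

theorem le_weakIndex (G : ℕ → List (List Bool)) (n : ℕ) : n ≤ weakIndex G n := by
  induction n with
  | zero => exact Nat.zero_le _
  | succ n ih => rw [weakIndex_succ]; omega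

theorem isWeakTest_fill {G : ℕ → List (List Bool)} (hG : IsTest G) :
    IsWeakTest fun n => fill (G (weakIndex G n)) := by
  have hp : Primrec fun n => G (weakIndex G n) := hG.1.comp (primrec_weakIndex hG.1)
  refine ⟨⟨primrec_fill.comp hp, fun n => ?_⟩, fun n => maxLen (G (weakIndex G n)),
    primrec_maxLen.comp hp, fun n τ => length_of_mem_fill, fun n τ hτ => ?_⟩
  · rw [mu_fill]
    refine (hG.2 _).trans ?_
    gcongr
    · norm_num
    · exact le_weakIndex G n
  · have hlen := length_of_mem_fill hτ
    have hsucc := weakIndex_succ G n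
    have hmu := hG.2 (weakIndex G (n + 1))
    by_cases hne : fill (G (weakIndex G (n + 1))) = []
    · simp only [hne, muCap]
      simp
    · have hle := le_maxLen_of_mu_le hne hmu
      have hτle : τ.length ≤ maxLen (fill (G (weakIndex G (n + 1)))) := by
        rw [maxLen_fill hne]; omega
      refine (muCap_le_mu hτle).trans ?_
      rw [mu_fill]
      refine hmu.trans ?_
      rw [one_div, ← mul_inv, ← pow_succ']
      gcongr
      · norm_num
      · omega

theorem stmt1 (X : ℕ → Bool) :
    MLBPRandom X ↔ ∀ G : ℕ → List (List Bool), IsWeakTest G → ∃ n, ¬ Mem X (G n) := by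
  constructor
  · exact fun h G hG => h G hG.1
  · intro h G hG
    obtain ⟨n, hn⟩ := h _ (isWeakTest_fill hG)
    exact ⟨weakIndex G n, fun hX => hn (mem_fill hX)⟩

end BP
end

section
/- (Analogue of Ville's theorem) Let X be a Martin-Löf BP random real and let g : ℕ → ℕ be a strictly increasing primitive recursive function. Then the real Y defined by Y(n) = X(g(n)) is also Martin-Löf BP random. -/
namespace BP



/-- The string `(σ (g 0), …, σ (g (L−1)))`, with `false` at positions beyond the end of `σ`. -/
def pull (g : ℕ → ℕ) (L : ℕ) (σ : List Bool) : List Bool :=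
  (List.range L).map fun i => σ.getD (g i) false

/-- The strings `σ` of length `g (maxLen G)` whose subsequence along `g` extends a member
of `G`. -/
def pullback (g : ℕ → ℕ) (G : List (List Bool)) : List (List Bool) :=
  (allStrings (g (maxLen G))).filter fun σ => ∃ τ ∈ G, τ <+: pull g (maxLen G) σ

section Strings

theorem length_take (X : ℕ → Bool) (n : ℕ) : (take X n).length = n := by simp [take]

theorem length_pull (g : ℕ → ℕ) (L : ℕ) (σ : List Bool) : (pull g L σ).length = L := by
  simp [pull]

theorem mem_allStrings {L : ℕ} {σ : List Bool} : σ ∈ allStrings L ↔ σ.length = L := by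
  constructor
  · intro h
    obtain ⟨k, -, rfl⟩ := List.mem_map.1 h
    simp
  · rintro rfl
    refine List.mem_map.2 ⟨Nat.ofBits fun i : Fin σ.length => σ[i],
      List.mem_range.2 (Nat.ofBits_lt_two_pow _), ?_⟩
    refine List.ext_getElem (by simp) fun i _ h => ?_
    simp [Nat.testBit_ofBits_lt _ _ h]

theorem nodup_allStrings (L : ℕ) : (allStrings L).Nodup := by
  refine List.Nodup.map_on (fun a ha b hb hab => ?_) List.nodup_range
  rw [List.mem_range] at ha hb
  refine Nat.eq_of_testBit_eq fun i => ?_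
  rcases lt_or_ge i L with hi | hi
  · exact List.map_inj_left.1 hab i (List.mem_range.2 hi)
  · have hp : 2 ^ L ≤ 2 ^ i := Nat.pow_le_pow_right two_pos hi
    rw [Nat.testBit_lt_two_pow (ha.trans_le hp), Nat.testBit_lt_two_pow (hb.trans_le hp)]

theorem maxLen_le {G : List (List Bool)} {N : ℕ} (h : ∀ τ ∈ G, τ.length ≤ N) :
    maxLen G ≤ N := by
  induction G with
  | nil => exact Nat.zero_le _
  | cons a G ih =>
    exact max_le (h a List.mem_cons_self) (ih fun τ hτ => h τ (List.mem_cons_of_mem _ hτ))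

theorem mem_pullback {g : ℕ → ℕ} {G : List (List Bool)} {σ : List Bool} :
    σ ∈ pullback g G ↔
      σ.length = g (maxLen G) ∧ ∃ τ ∈ G, τ <+: pull g (maxLen G) σ := by
  simp [pullback, mem_allStrings]

theorem take_prefix_take (X : ℕ → Bool) {m n : ℕ} (h : m ≤ n) : take X m <+: take X n := by
  rw [List.prefix_iff_getElem?]
  intro i hi
  rw [length_take] at hi
  simp [take, hi.trans_le h]

theorem pull_take (X : ℕ → Bool) {g : ℕ → ℕ} (hg : StrictMono g) (L : ℕ) :
    pull g L (take X (g L)) = take (fun n => X (g n)) L := by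
  refine List.map_congr_left fun i hi => ?_
  have : g i < g L := hg (List.mem_range.1 hi)
  simp [take, List.getD_eq_getElem?_getD, this]

theorem mem_pullback_of_mem {X : ℕ → Bool} {g : ℕ → ℕ} (hg : StrictMono g)
    {G : List (List Bool)} (h : Mem (fun n => X (g n)) G) : Mem X (pullback g G) := by
  obtain ⟨τ, hτ, e⟩ := h
  refine ⟨take X (g (maxLen G)), mem_pullback.2 ⟨length_take _ _, τ, hτ, ?_⟩, ?_⟩
  · rw [pull_take X hg, ← e]
    exact take_prefix_take _ (length_le_maxLen hτ)
  · rw [length_take]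

end Strings

section Measure

/-- Each string of length `L` is the subsequence along `g` of at most `2 ^ (g L - L)` strings of
length `g L`. -/
theorem card_filter_pull_le {g : ℕ → ℕ} (hg : StrictMono g) (L : ℕ) (p : List Bool → Bool) :
    ((allStrings (g L)).filter fun σ => p (pull g L σ)).length ≤
      ((allStrings L).filter p).length * 2 ^ (g L - L) := by
  classical
  set C : Finset ℕ := Finset.range (g L) \ (Finset.range L).image g with hC
  have hlt : ∀ i < L, g i < g L := fun i hi => hg hi
  have hcard : C.card = g L - L := by
    rw [hC, Finset.card_sdiff_of_subset, Finset.card_image_of_injective _ hg.injective,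
      Finset.card_range, Finset.card_range]
    intro x hx
    obtain ⟨i, hi, rfl⟩ := Finset.mem_image.1 hx
    exact Finset.mem_range.2 (hlt i (Finset.mem_range.1 hi))
  rw [← List.toFinset_card_of_nodup ((nodup_allStrings (g L)).filter _)]
  calc _ ≤ (((allStrings L).filter p).toFinset ×ˢ (Finset.univ : Finset (C → Bool))).card := by
        refine Finset.card_le_card_of_injOn
          (fun σ => (pull g L σ, fun i : C => σ.getD i false)) ?_ ?_
        · intro σ hσ
          simp only [List.coe_toFinset, Set.mem_ofPred_eq, List.mem_filter] at hσ
          simp [mem_allStrings, length_pull, hσ.2]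
        · intro σ hσ ρ hρ h
          simp only [List.coe_toFinset, Set.mem_ofPred_eq, List.mem_filter, mem_allStrings] at hσ hρ
          obtain ⟨h₁, h₂⟩ := Prod.mk.inj h
          refine List.ext_getElem (hσ.1.trans hρ.1.symm) fun j hj hj' => ?_
          rw [← List.getD_eq_getElem _ false hj, ← List.getD_eq_getElem _ false hj']
          by_cases hjC : j ∈ C
          · exact congrFun h₂ ⟨j, hjC⟩
          · have : j ∈ (Finset.range L).image g := by
              by_contra hn
              exact hjC (Finset.mem_sdiff.2 ⟨Finset.mem_range.2 (hσ.1 ▸ hj), hn⟩)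
            obtain ⟨i, hi, rfl⟩ := Finset.mem_image.1 this
            exact List.map_inj_left.1 h₁ i (List.mem_range.2 (Finset.mem_range.1 hi))
    _ ≤ _ := by
        rw [Finset.card_product, Finset.card_univ, Fintype.card_fun, Fintype.card_bool,
          Fintype.card_coe, hcard]
        exact Nat.mul_le_mul_right _ (List.toFinset_card_le _)

theorem mu_pullback_le {g : ℕ → ℕ} (hg : StrictMono g) (G : List (List Bool)) :
    mu (pullback g G) ≤ mu G := by
  rcases eq_or_ne (pullback g G) [] with h | h
  · rw [h]
    simp only [mu, List.any_nil, List.filter_false, List.length_nil, Nat.cast_zero, zero_div]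
    positivity
  obtain ⟨σ₀, h₀⟩ := List.exists_mem_of_ne_nil _ h
  have hlen : maxLen (pullback g G) = g (maxLen G) :=
    le_antisymm (maxLen_le fun τ hτ => (mem_pullback.1 hτ).1.le)
      ((mem_pullback.1 h₀).1.ge.trans (length_le_maxLen h₀))
  set L := maxLen G with hL
  set p : List Bool → Bool := fun σ => G.any fun τ => decide (τ <+: σ) with hp
  have hfilter : ((allStrings (g L)).filter fun σ =>
      (pullback g G).any fun τ => decide (τ <+: σ)) =
      (allStrings (g L)).filter fun σ => p (pull g L σ) := by
    refine List.filter_congr fun σ hσ => ?_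
    rw [mem_allStrings] at hσ
    rw [Bool.eq_iff_iff, hp]
    simp only [List.any_eq_true, decide_eq_true_eq]
    constructor
    · rintro ⟨τ, hτ, hpre⟩
      have hτ' := mem_pullback.1 hτ
      rw [← hpre.eq_of_length (hτ'.1.trans hσ.symm)]
      exact hτ'.2
    · intro h
      exact ⟨σ, mem_pullback.2 ⟨hσ, h⟩, List.prefix_rfl⟩
  have hle : L ≤ g L := hg.le_apply
  have key : (((allStrings (g L)).filter fun σ => p (pull g L σ)).length : ℚ) ≤
      ((allStrings L).filter p).length * 2 ^ (g L - L) := by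
    exact_mod_cast card_filter_pull_le hg L p
  rw [mu, hlen, hfilter, mu, ← hL, div_le_div_iff₀ (by positivity) (by positivity)]
  calc _ ≤ (((allStrings L).filter p).length * 2 ^ (g L - L) : ℚ) * 2 ^ L := by gcongr
    _ = _ := by rw [mul_assoc, ← pow_add, Nat.sub_add_cancel hle]

end Measure

section PrimitiveRecursion

theorem primrecRel_isPrefix_s7 {α : Type*} [Primcodable α] :
    PrimrecRel fun l₁ l₂ : List α => l₁ <+: l₂ := by
  have h : PrimrecRel fun (i : ℕ) (l : List α × List α) => l.2[i]? = l.1[i]? :=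
    Primrec.eq.comp
      (Primrec.list_getElem?.comp (Primrec.snd.comp Primrec.snd) Primrec.fst)
      (Primrec.list_getElem?.comp (Primrec.fst.comp Primrec.snd) Primrec.fst)
  refine (h.forall_mem_list.comp (Primrec.list_range.comp (Primrec.list_length.comp Primrec.fst))
    Primrec.id).of_eq fun l => ?_
  simp only [List.prefix_iff_getElem?, List.mem_range, id]
  exact forall₂_congr fun i hi => by rw [List.getElem?_eq_getElem hi]

theorem primrec_pull {g : ℕ → ℕ} (hg : Primrec g) : Primrec₂ (pull g) :=
  Primrec.list_map (Primrec.list_range.comp Primrec.fst)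
    ((Primrec.list_getD false).comp (Primrec.snd.comp Primrec.fst) (hg.comp Primrec.snd)).to₂

theorem primrec_pullback {g : ℕ → ℕ} (hg : Primrec g) : Primrec (pullback g) := by
  have hR : PrimrecRel fun (σ : List Bool) (G : List (List Bool)) =>
      ∃ τ ∈ G, τ <+: pull g (maxLen G) σ :=
    PrimrecRel.comp (primrecRel_isPrefix_s7.exists_mem_list) Primrec.snd
      ((primrec_pull hg).comp (primrec_maxLen.comp Primrec.snd) Primrec.fst)
  exact hR.listFilter.comp (primrec_allStrings.comp (hg.comp primrec_maxLen)) Primrec.id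

end PrimitiveRecursion

theorem stmt7 (X : ℕ → Bool) (g : ℕ → ℕ) (hX : MLBPRandom X)
    (hg : Primrec g) (hmono : StrictMono g) : MLBPRandom fun n => X (g n) := by
  intro G hG
  obtain ⟨n, hn⟩ := hX (fun n => pullback g (G n))
    ⟨(primrec_pullback hg).comp hG.1, fun n => (mu_pullback_le hmono (G n)).trans (hG.2 n)⟩
  exact ⟨n, fun h => hn (mem_pullback_of_mem hmono h)⟩

end BP
end
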